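/- arXiv:1810.08662 — 3 statements merged into one kernel-verified Lean document; each statement's English description precedes it below -/
import Mathlib

section
/- Let A and B be n×n matrices with nonnegative real entries whose tropical spectral radii μ = λ(A) and ν = λ(B) are positive, and let G and H be the associated functions. If μ < G(ν), then the Pareto frontier of the problem of minimizing (f(x), g(x)) over positive vectors x ∈ ℝⁿ equals the set {(α, H(α)) : μ ≤ α ≤ G(ν)}. -/
open scoped BigOperators

noncomputable section

/-- Tropical (max-times) matrix product. -/
def tmul {n : ℕ} (A B : Matrix (Fin n) (Fin n) ℝ) : Matrix (Fin n) (Fin n) ℝ :=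
  Matrix.of fun i j => ⨆ k, A i k * B k j

/-- Tropical matrix power: `A^0 = I`, `A^(k+1) = A ⊗ A^k`. -/
def tpow {n : ℕ} (A : Matrix (Fin n) (Fin n) ℝ) : ℕ → Matrix (Fin n) (Fin n) ℝ
  | 0 => Matrix.of fun i j => if i = j then (1 : ℝ) else 0
  | k + 1 => tmul A (tpow A k)

/-- Tropical trace: `tr A = max_i A i i`. -/
def ttr {n : ℕ} (A : Matrix (Fin n) (Fin n) ℝ) : ℝ := ⨆ i, A i i

/-- `Tr(A) = max_{1 ≤ k ≤ n} tr (A^k)`. -/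
def tTr {n : ℕ} (A : Matrix (Fin n) (Fin n) ℝ) : ℝ :=
  ⨆ k : Fin n, ttr (tpow A (k.1 + 1))

/-- Tropical spectral radius: `λ(A) = max_{1 ≤ k ≤ n} (tr (A^k))^(1/k)`. -/
def specRad {n : ℕ} (A : Matrix (Fin n) (Fin n) ℝ) : ℝ :=
  ⨆ k : Fin n, (ttr (tpow A (k.1 + 1))) ^ ((1 : ℝ) / ((k.1 : ℝ) + 1))

/-- Kleene star: `A* = I ⊕ A ⊕ ⋯ ⊕ A^(n-1)` (entrywise max of tropical powers). -/
def kstar {n : ℕ} (A : Matrix (Fin n) (Fin n) ℝ) : Matrix (Fin n) (Fin n) ℝ :=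
  Matrix.of fun i j => ⨆ k : Fin n, tpow A k.1 i j

/-- `B ⊗ A^(i₁) ⊗ B ⊗ A^(i₂) ⊗ ⋯ ⊗ B ⊗ A^(i_k)` for a list `(i₁, …, i_k)`. -/
def wordProd {n : ℕ} (A B : Matrix (Fin n) (Fin n) ℝ) : List ℕ → Matrix (Fin n) (Fin n) ℝ
  | [] => tpow A 0
  | i :: l => tmul (tmul B (tpow A i)) (wordProd A B l)

/-- The function `G(s)` associated with matrices `A`, `B`. -/
def Gfun {n : ℕ} (A B : Matrix (Fin n) (Fin n) ℝ) (s : ℝ) : ℝ :=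
  sSup { v : ℝ | ∃ (k m : ℕ) (t : Fin k → ℕ),
    1 ≤ k ∧ k ≤ n - 1 ∧ 1 ≤ m ∧ m ≤ n - k ∧ (∑ j, t j) = m ∧
    v = s ^ (-(k : ℝ) / (m : ℝ)) *
      (ttr (wordProd A B (List.ofFn t))) ^ ((1 : ℝ) / (m : ℝ)) }

/-- The function `H(t)` associated with matrices `A`, `B`. -/
def Hfun {n : ℕ} (A B : Matrix (Fin n) (Fin n) ℝ) (t : ℝ) : ℝ :=
  sSup { v : ℝ | ∃ (k m : ℕ) (w : Fin k → ℕ),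
    1 ≤ k ∧ k ≤ n - 1 ∧ 1 ≤ m ∧ m ≤ n - k ∧ (∑ j, w j) = m ∧
    v = t ^ (-(m : ℝ) / (k : ℝ)) *
      (ttr (wordProd A B (List.ofFn w))) ^ ((1 : ℝ) / (k : ℝ)) }

/-- The objective `f(x) = max_{i,j} A i j * x j / x i`. -/
def obj {n : ℕ} (A : Matrix (Fin n) (Fin n) ℝ) (x : Fin n → ℝ) : ℝ :=
  ⨆ i, ⨆ j, A i j * x j / x i

/-- `x` is a positive Pareto-optimal point for minimizing `(obj A, obj B)`. -/
def ParetoOptimal {n : ℕ} (A B : Matrix (Fin n) (Fin n) ℝ) (x : Fin n → ℝ) : Prop :=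
  (∀ i, 0 < x i) ∧
    ¬ ∃ y : Fin n → ℝ, (∀ i, 0 < y i) ∧ obj A y ≤ obj A x ∧ obj B y ≤ obj B x ∧
      (obj A y, obj B y) ≠ (obj A x, obj B x)

/-- The Pareto frontier of the bi-objective problem. -/
def ParetoFrontier {n : ℕ} (A B : Matrix (Fin n) (Fin n) ℝ) : Set (ℝ × ℝ) :=
  { p | ∃ x : Fin n → ℝ, ParetoOptimal A B x ∧ p = (obj A x, obj B x) }

lemma le_sup {ι : Type*} [Finite ι] (f : ι → ℝ) (i : ι) : f i ≤ ⨆ i, f i :=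
  le_ciSup (Set.finite_range f).bddAbove i

lemma tmul_ge {n : ℕ} (A B : Matrix (Fin n) (Fin n) ℝ) (i k j : Fin n) :
    A i k * B k j ≤ tmul A B i j := le_sup (fun k => A i k * B k j) k

lemma tmul_nonneg {n : ℕ} {A B : Matrix (Fin n) (Fin n) ℝ}
    (hA : ∀ i j, 0 ≤ A i j) (hB : ∀ i j, 0 ≤ B i j) (i j : Fin n) : 0 ≤ tmul A B i j :=
  Real.iSup_nonneg fun k => mul_nonneg (hA i k) (hB k j)

lemma tpow_nonneg {n : ℕ} {A : Matrix (Fin n) (Fin n) ℝ}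
    (hA : ∀ i j, 0 ≤ A i j) (k : ℕ) : ∀ i j, 0 ≤ tpow A k i j := by
  induction k with
  | zero => intro i j; simp only [tpow, Matrix.of_apply]; split_ifs <;> norm_num
  | succ k ih => exact fun i j => tmul_nonneg hA ih i j

lemma wordProd_nonneg {n : ℕ} {A B : Matrix (Fin n) (Fin n) ℝ}
    (hA : ∀ i j, 0 ≤ A i j) (hB : ∀ i j, 0 ≤ B i j) (l : List ℕ) :
    ∀ i j, 0 ≤ wordProd A B l i j := by
  induction l with
  | nil => exact tpow_nonneg hA 0
  | cons a l ih => exact tmul_nonneg (tmul_nonneg hB (tpow_nonneg hA a)) ih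

lemma ttr_nonneg {n : ℕ} {A : Matrix (Fin n) (Fin n) ℝ}
    (hA : ∀ i j, 0 ≤ A i j) : 0 ≤ ttr A := Real.iSup_nonneg fun i => hA i i

def Bd {n : ℕ} (x : Fin n → ℝ) (M : Matrix (Fin n) (Fin n) ℝ) (c : ℝ) : Prop :=
  ∀ i j, M i j * x j ≤ c * x i

lemma Bd.tmul {n : ℕ} {x : Fin n → ℝ} {M N : Matrix (Fin n) (Fin n) ℝ} {c d : ℝ}
    (hM0 : ∀ i j, 0 ≤ M i j) (hd : 0 ≤ d)
    (hM : Bd x M c) (hN : Bd x N d) : Bd x (tmul M N) (c * d) := by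
  intro i j
  have : Nonempty (Fin n) := ⟨i⟩
  obtain ⟨k, hk⟩ := exists_eq_ciSup_of_finite (f := fun k => M i k * N k j)
  have : _root_.tmul M N i j = M i k * N k j := hk.symm
  rw [this]
  calc M i k * N k j * x j = M i k * (N k j * x j) := by ring
    _ ≤ M i k * (d * x k) := mul_le_mul_of_nonneg_left (hN k j) (hM0 i k)
    _ = d * (M i k * x k) := by ring
    _ ≤ d * (c * x i) := mul_le_mul_of_nonneg_left (hM i k) hd
    _ = _ := by ring

lemma Bd.tpow {n : ℕ} {x : Fin n → ℝ} (hx : ∀ i, 0 < x i)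
    {M : Matrix (Fin n) (Fin n) ℝ} {c : ℝ}
    (hM0 : ∀ i j, 0 ≤ M i j) (hc : 0 ≤ c)
    (hM : Bd x M c) (k : ℕ) : Bd x (tpow M k) (c ^ k) := by
  induction k with
  | zero =>
    intro i j
    simp only [_root_.tpow, Matrix.of_apply]
    split_ifs with h
    · subst h; simp
    · simpa using (hx i).le
  | succ k ih => rw [pow_succ']; exact Bd.tmul hM0 (by positivity) hM ih

lemma Bd.wordProd {n : ℕ} {x : Fin n → ℝ} (hx : ∀ i, 0 < x i)
    {A B : Matrix (Fin n) (Fin n) ℝ} {a b : ℝ}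
    (hA : ∀ i j, 0 ≤ A i j) (hB : ∀ i j, 0 ≤ B i j) (ha : 0 ≤ a) (hb : 0 ≤ b)
    (hAa : Bd x A a) (hBb : Bd x B b) (l : List ℕ) :
    Bd x (wordProd A B l) (a ^ l.sum * b ^ l.length) := by
  induction l with
  | nil => simpa [_root_.wordProd] using Bd.tpow hx hA ha hAa 0
  | cons i l ih =>
    have := Bd.tmul (tmul_nonneg hB (tpow_nonneg hA i)) (by positivity)
      (Bd.tmul hB (by positivity) hBb (Bd.tpow hx hA ha hAa i)) ih
    have e : a ^ (i :: l).sum * b ^ (i :: l).length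
        = b * a ^ i * (a ^ l.sum * b ^ l.length) := by
      simp [pow_add]; ring
    rw [e]; exact this

lemma Bd.ttr {n : ℕ} {x : Fin n → ℝ} (hx : ∀ i, 0 < x i)
    {M : Matrix (Fin n) (Fin n) ℝ} {c : ℝ} (hc : 0 ≤ c) (h : Bd x M c) : ttr M ≤ c :=
  Real.iSup_le (fun i => le_of_mul_le_mul_right (h i i) (hx i)) hc

lemma obj_nonneg {n : ℕ} {x : Fin n → ℝ} (hx : ∀ i, 0 < x i)
    {A : Matrix (Fin n) (Fin n) ℝ} (hA : ∀ i j, 0 ≤ A i j) : 0 ≤ obj A x :=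
  Real.iSup_nonneg fun i => Real.iSup_nonneg fun j =>
    div_nonneg (mul_nonneg (hA i j) (hx j).le) (hx i).le

lemma Bd_obj {n : ℕ} {x : Fin n → ℝ} (hx : ∀ i, 0 < x i)
    (A : Matrix (Fin n) (Fin n) ℝ) : Bd x A (obj A x) := by
  intro i j
  rw [← div_le_iff₀ (hx i)]
  exact (le_sup (fun j => A i j * x j / x i) j).trans
    (le_sup (fun i => ⨆ j, A i j * x j / x i) i)

lemma obj_le {n : ℕ} {x : Fin n → ℝ} (hx : ∀ i, 0 < x i)
    {A : Matrix (Fin n) (Fin n) ℝ} {c : ℝ} (hc : 0 ≤ c) (h : Bd x A c) : obj A x ≤ c :=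
  Real.iSup_le (fun i => Real.iSup_le (fun j => (div_le_iff₀ (hx i)).2 (h i j)) hc) hc

lemma specRad_le_iff {n : ℕ} {A : Matrix (Fin n) (Fin n) ℝ} (hA : ∀ i j, 0 ≤ A i j)
    {c : ℝ} (hc : 0 ≤ c) :
    specRad A ≤ c ↔ ∀ k, 1 ≤ k → k ≤ n → ttr (tpow A k) ≤ c ^ k := by
  have key : ∀ k : ℕ, (ttr (tpow A (k + 1))) ^ ((1 : ℝ) / ((k : ℝ) + 1)) ≤ c ↔
      ttr (tpow A (k + 1)) ≤ c ^ (k + 1) := by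
    intro k
    have h0 := ttr_nonneg (tpow_nonneg hA (k + 1))
    rw [one_div, Real.rpow_inv_le_iff_of_pos h0 hc (by positivity)]
    norm_cast
  constructor
  · intro h k h1 h2
    obtain ⟨k, rfl⟩ : ∃ j, k = j + 1 := ⟨k - 1, by omega⟩
    rw [← key]
    exact (le_sup (fun k : Fin n => (ttr (tpow A (k.1 + 1))) ^ ((1 : ℝ) / ((k.1 : ℝ) + 1)))
      ⟨k, h2⟩).trans h
  · intro h
    exact Real.iSup_le (fun k => (key k).2 (h _ (by omega) (by omega))) hc

/-- Mixed cycle condition. -/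
def PP {n : ℕ} (A B : Matrix (Fin n) (Fin n) ℝ) (a b : ℝ) : Prop :=
  ∀ (k m : ℕ) (t : Fin k → ℕ), 1 ≤ k → k ≤ n - 1 → 1 ≤ m → m ≤ n - k → (∑ j, t j) = m →
    ttr (wordProd A B (List.ofFn t)) ≤ a ^ m * b ^ k

lemma finite_idx {n : ℕ} (F : (k m : ℕ) → (Fin k → ℕ) → ℝ) :
    { v : ℝ | ∃ (k m : ℕ) (t : Fin k → ℕ),
    1 ≤ k ∧ k ≤ n - 1 ∧ 1 ≤ m ∧ m ≤ n - k ∧ (∑ j, t j) = m ∧ v = F k m t }.Finite := by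
  have : (⋃ k ∈ Set.Iic n, ⋃ m ∈ Set.Iic n,
      (F k m) '' (Set.Icc 0 (fun _ => m))).Finite := by
    refine (Set.finite_Iic n).biUnion fun k _ => (Set.finite_Iic n).biUnion fun m _ => ?_
    exact (Set.finite_Icc _ _).image _
  refine this.subset ?_
  rintro v ⟨k, m, t, h1, h2, h3, h4, h5, rfl⟩
  simp only [Set.mem_iUnion]
  refine ⟨k, by simp; omega, m, by simp; omega, t, ⟨fun _ => Nat.zero_le _, fun j => ?_⟩, rfl⟩
  show t j ≤ m
  rw [← h5]
  exact Finset.single_le_sum (f := t) (fun _ _ => Nat.zero_le _) (Finset.mem_univ j)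

lemma real_aux {s a r : ℝ} (hs : 0 < s) (ha : 0 < a) (hr : 0 ≤ r) {k m : ℕ} (hm : 1 ≤ m) :
    s ^ (-(k : ℝ) / (m : ℝ)) * r ^ ((1 : ℝ) / (m : ℝ)) ≤ a ↔ r ≤ a ^ m * s ^ k := by
  have hm' : (0 : ℝ) < m := by exact_mod_cast hm
  have e : s ^ (-(k : ℝ) / (m : ℝ)) * r ^ ((1 : ℝ) / (m : ℝ)) = (r / s ^ k) ^ ((m : ℝ)⁻¹) := by
    rw [Real.div_rpow hr (by positivity), ← Real.rpow_natCast s k, ← Real.rpow_mul hs.le,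
      neg_div, Real.rpow_neg hs.le, one_div, div_eq_mul_inv (k : ℝ)]
    field_simp
  rw [e, Real.rpow_inv_le_iff_of_pos (by positivity) ha.le hm', Real.rpow_natCast,
    div_le_iff₀ (by positivity)]

lemma G_le_iff {n : ℕ} {A B : Matrix (Fin n) (Fin n) ℝ}
    (hA : ∀ i j, 0 ≤ A i j) (hB : ∀ i j, 0 ≤ B i j) {a s : ℝ} (ha : 0 < a) (hs : 0 < s) :
    Gfun A B s ≤ a ↔ PP A B a s := by
  constructor
  · intro h k m t h1 h2 h3 h4 h5
    rw [← real_aux hs ha (ttr_nonneg (wordProd_nonneg hA hB _)) h3]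
    refine le_trans (le_csSup (finite_idx _).bddAbove ?_) h
    exact ⟨k, m, t, h1, h2, h3, h4, h5, rfl⟩
  · intro h
    refine Real.sSup_le ?_ ha.le
    rintro v ⟨k, m, t, h1, h2, h3, h4, h5, rfl⟩
    rw [real_aux hs ha (ttr_nonneg (wordProd_nonneg hA hB _)) h3]
    exact h k m t h1 h2 h3 h4 h5

lemma H_le_iff {n : ℕ} {A B : Matrix (Fin n) (Fin n) ℝ}
    (hA : ∀ i j, 0 ≤ A i j) (hB : ∀ i j, 0 ≤ B i j) {a s : ℝ} (ha : 0 < a) (hs : 0 < s) :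
    Hfun A B a ≤ s ↔ PP A B a s := by
  constructor
  · intro h k m t h1 h2 h3 h4 h5
    rw [mul_comm, ← real_aux ha hs (ttr_nonneg (wordProd_nonneg hA hB _)) h1]
    refine le_trans (le_csSup (finite_idx _).bddAbove ?_) h
    exact ⟨k, m, t, h1, h2, h3, h4, h5, rfl⟩
  · intro h
    refine Real.sSup_le ?_ hs.le
    rintro v ⟨k, m, t, h1, h2, h3, h4, h5, rfl⟩
    rw [real_aux ha hs (ttr_nonneg (wordProd_nonneg hA hB _)) h1, mul_comm]
    exact h k m t h1 h2 h3 h4 h5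

lemma theta {n : ℕ} (hn : n ≠ 0) {r : ℝ} (h0 : 0 < r) (h1 : r < 1) :
    ∃ θ : ℝ, 0 < θ ∧ θ < 1 ∧ ∀ p q : ℕ, 1 ≤ p → q ≤ n → r ^ p ≤ θ ^ q := by
  have e : (r ^ ((n : ℝ)⁻¹)) ^ n = r := Real.rpow_inv_natCast_pow h0.le hn
  refine ⟨r ^ ((n : ℝ)⁻¹), by positivity, Real.rpow_lt_one h0.le h1 (by positivity), ?_⟩
  intro p q hp hq
  calc r ^ p ≤ r ^ 1 := pow_le_pow_of_le_one h0.le h1.le hp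
    _ = (r ^ ((n : ℝ)⁻¹)) ^ n := by rw [e, pow_one]
    _ ≤ _ := pow_le_pow_of_le_one (by positivity)
      (Real.rpow_lt_one h0.le h1 (by positivity)).le hq

lemma strict1 {n : ℕ} (hn : n ≠ 0) {A B : Matrix (Fin n) (Fin n) ℝ} {a a' b : ℝ}
    (ha : 0 < a) (haa : a < a') (hb : 0 < b) (h : PP A B a b) :
    ∃ b', 0 < b' ∧ b' < b ∧ PP A B a' b' := by
  have ha' : 0 < a' := ha.trans haa
  obtain ⟨θ, t0, t1, ht⟩ := theta hn (div_pos ha ha') ((div_lt_one ha').2 haa)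
  refine ⟨b * θ, by positivity, by nlinarith, ?_⟩
  intro k m t h1 h2 h3 h4 h5
  refine (h k m t h1 h2 h3 h4 h5).trans ?_
  have := ht m k h3 (by omega)
  rw [div_pow, div_le_iff₀ (by positivity)] at this
  rw [mul_pow]
  calc a ^ m * b ^ k ≤ (θ ^ k * a' ^ m) * b ^ k := by gcongr
    _ = _ := by ring

lemma strict2 {n : ℕ} (hn : n ≠ 0) {A B : Matrix (Fin n) (Fin n) ℝ} {a b b' : ℝ}
    (ha : 0 < a) (hbb : b < b') (hb : 0 < b) (h : PP A B a b) :
    ∃ a', 0 < a' ∧ a' < a ∧ PP A B a' b' := by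
  have hb' : 0 < b' := hb.trans hbb
  obtain ⟨θ, t0, t1, ht⟩ := theta hn (div_pos hb hb') ((div_lt_one hb').2 hbb)
  refine ⟨a * θ, by positivity, by nlinarith, ?_⟩
  intro k m t h1 h2 h3 h4 h5
  refine (h k m t h1 h2 h3 h4 h5).trans ?_
  have := ht k m h1 (by omega)
  rw [div_pow, div_le_iff₀ (by positivity)] at this
  rw [mul_pow]
  calc a ^ m * b ^ k ≤ a ^ m * (θ ^ m * b' ^ k) := by gcongr
    _ = _ := by ring

/-- Necessity. -/
lemma nec {n : ℕ} {A B : Matrix (Fin n) (Fin n) ℝ}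
    (hA : ∀ i j, 0 ≤ A i j) (hB : ∀ i j, 0 ≤ B i j) {x : Fin n → ℝ} (hx : ∀ i, 0 < x i) :
    specRad A ≤ obj A x ∧ specRad B ≤ obj B x ∧ PP A B (obj A x) (obj B x) := by
  have a0 := obj_nonneg hx hA
  have b0 := obj_nonneg hx hB
  refine ⟨(specRad_le_iff hA a0).2 fun k _ _ =>
      (Bd.tpow hx hA a0 (Bd_obj hx A) k).ttr hx (by positivity),
    (specRad_le_iff hB b0).2 fun k _ _ =>
      (Bd.tpow hx hB b0 (Bd_obj hx B) k).ttr hx (by positivity), ?_⟩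
  intro k m t h1 h2 h3 h4 h5
  have := (Bd.wordProd hx hA hB a0 b0 (Bd_obj hx A) (Bd_obj hx B) (List.ofFn t)).ttr hx
    (by positivity)
  rwa [List.length_ofFn, List.sum_ofFn, h5] at this

/-! Walks -/

def wt {n : ℕ} (M : Bool → Matrix (Fin n) (Fin n) ℝ) : Fin n → List (Bool × Fin n) → ℝ
  | _, [] => 1
  | i, q :: l => M q.1 i q.2 * wt M q.2 l

def en {n : ℕ} : Fin n → List (Bool × Fin n) → Fin n
  | i, [] => i
  | _, q :: l => en q.2 l

lemma en_append {n : ℕ} (l₁ l₂ : List (Bool × Fin n)) (i : Fin n) :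
    en i (l₁ ++ l₂) = en (en i l₁) l₂ := by
  induction l₁ generalizing i with
  | nil => rfl
  | cons q l ih => exact ih q.2

lemma wt_append {n : ℕ} (M : Bool → Matrix (Fin n) (Fin n) ℝ) (l₁ l₂ : List (Bool × Fin n))
    (i : Fin n) : wt M i (l₁ ++ l₂) = wt M i l₁ * wt M (en i l₁) l₂ := by
  induction l₁ generalizing i with
  | nil => simp [wt, en]
  | cons q l ih => simp [wt, en, ih, mul_assoc]

lemma wt_nonneg {n : ℕ} {M : Bool → Matrix (Fin n) (Fin n) ℝ} (hM : ∀ b i j, 0 ≤ M b i j)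
    (l : List (Bool × Fin n)) (i : Fin n) : 0 ≤ wt M i l := by
  induction l generalizing i with
  | nil => simp [wt]
  | cons q l ih => exact mul_nonneg (hM _ _ _) (ih _)

lemma wt_pure {n : ℕ} {M : Bool → Matrix (Fin n) (Fin n) ℝ} (hM : ∀ b i j, 0 ≤ M b i j)
    (b : Bool) (l : List (Bool × Fin n)) (hl : ∀ q ∈ l, q.1 = b) (i : Fin n) :
    wt M i l ≤ tpow (M b) l.length i (en i l) := by
  induction l generalizing i with
  | nil => simp [wt, en, tpow]
  | cons q l ih =>
    have hq : q.1 = b := hl q (by simp)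
    have h := ih (fun q hq => hl q (by simp [hq])) q.2
    simp only [wt, en, List.length_cons, tpow, hq]
    exact (mul_le_mul_of_nonneg_left h (hM b i q.2)).trans (tmul_ge _ _ _ _ _)

def nc {n : ℕ} (b : Bool) (l : List (Bool × Fin n)) : ℕ := l.countP (fun q => q.1 == b)

lemma nc_add {n : ℕ} (l : List (Bool × Fin n)) : nc true l + nc false l = l.length := by
  induction l with
  | nil => rfl
  | cons q l ih =>
    obtain ⟨b, j⟩ := q
    cases b <;> simp [nc] at * <;> omega

lemma wt_word {n : ℕ} {A B : Matrix (Fin n) (Fin n) ℝ}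
    (hA : ∀ i j, 0 ≤ A i j) (hB : ∀ i j, 0 ≤ B i j) (l : List (Bool × Fin n)) (i : Fin n) :
    ∃ (a : ℕ) (L : List ℕ) (k : Fin n), a + L.sum = nc false l ∧ L.length = nc true l ∧
      wt (fun b => if b then B else A) i l ≤ tpow A a i k * wordProd A B L k (en i l) := by
  induction l generalizing i with
  | nil => exact ⟨0, [], i, rfl, rfl, by simp [wt, en, wordProd, tpow]⟩
  | cons q l ih =>
    obtain ⟨b, j⟩ := q
    obtain ⟨a, L, k, h1, h2, h3⟩ := ih j
    cases b
    · refine ⟨a + 1, L, k, by simp [nc] at *; omega, by simp [nc] at *; omega, ?_⟩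
      simp only [wt, en, Bool.false_eq_true, if_false]
      calc _ ≤ A i j * (tpow A a j k * wordProd A B L k (en j l)) :=
            mul_le_mul_of_nonneg_left h3 (hA i j)
        _ = (A i j * tpow A a j k) * wordProd A B L k (en j l) := by ring
        _ ≤ _ := mul_le_mul_of_nonneg_right (tmul_ge _ _ _ _ _) (wordProd_nonneg hA hB _ _ _)
    · refine ⟨0, a :: L, i, by simp [nc] at *; omega, by simp [nc] at *; omega, ?_⟩
      simp only [wt, en, if_true]
      have e : tpow A 0 i i = 1 := by simp [tpow]
      rw [e, one_mul]
      calc _ ≤ B i j * (tpow A a j k * wordProd A B L k (en j l)) :=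
            mul_le_mul_of_nonneg_left h3 (hB i j)
        _ = (B i j * tpow A a j k) * wordProd A B L k (en j l) := by ring
        _ ≤ tmul B (tpow A a) i k * wordProd A B L k (en j l) :=
            mul_le_mul_of_nonneg_right (tmul_ge _ _ _ _ _) (wordProd_nonneg hA hB _ _ _)
        _ ≤ _ := tmul_ge _ _ _ _ _

lemma nc_append {n : ℕ} (b : Bool) (l₁ l₂ : List (Bool × Fin n)) :
    nc b (l₁ ++ l₂) = nc b l₁ + nc b l₂ := List.countP_append

/-- closed walk bound -/
lemma closed_le {n : ℕ} {A B : Matrix (Fin n) (Fin n) ℝ}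
    (hA : ∀ i j, 0 ≤ A i j) (hB : ∀ i j, 0 ≤ B i j) {a b : ℝ} (ha : 0 < a) (hb : 0 < b)
    (h1 : specRad A ≤ a) (h2 : specRad B ≤ b) (h3 : PP A B a b)
    (l : List (Bool × Fin n)) (i : Fin n) (hl0 : 1 ≤ l.length) (hl : l.length ≤ n)
    (hc : en i l = i) :
    wt (fun b => if b then B else A) i l ≤ a ^ nc false l * b ^ nc true l := by
  have hM : ∀ (c : Bool) (i j : Fin n), 0 ≤ (if c then B else A) i j := by
    intro c i j; cases c <;> simp [hA, hB]
  have hadd := nc_add l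
  rw [specRad_le_iff hA ha.le] at h1
  rw [specRad_le_iff hB hb.le] at h2
  by_cases hF : nc false l = 0
  · have hp : ∀ q ∈ l, q.1 = true := by
      intro q hq
      have := (List.countP_eq_zero.1 hF) q hq
      simpa using this
    have h := wt_pure hM true l hp i
    rw [hc] at h
    have hT : nc true l = l.length := by omega
    rw [hF, hT, pow_zero, one_mul]
    exact h.trans ((le_sup (fun i => tpow B l.length i i) i).trans (h2 _ hl0 hl))
  by_cases hT : nc true l = 0
  · have hp : ∀ q ∈ l, q.1 = false := by
      intro q hq
      have := (List.countP_eq_zero.1 hT) q hq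
      simpa using this
    have h := wt_pure hM false l hp i
    rw [hc] at h
    have hF : nc false l = l.length := by omega
    rw [hF, hT, pow_zero, mul_one]
    exact h.trans ((le_sup (fun i => tpow A l.length i i) i).trans (h1 _ hl0 hl))
  obtain ⟨q, hq, hqt⟩ := List.countP_pos_iff.1 (Nat.pos_of_ne_zero hT)
  obtain ⟨l₁, l₂, rfl⟩ := List.append_of_mem hq
  obtain ⟨c, j⟩ := q
  have hct : c = true := by simpa using hqt
  subst hct
  have hrot : wt (fun b => if b then B else A) i (l₁ ++ (true, j) :: l₂)
      = B (en i l₁) j * wt (fun b => if b then B else A) j (l₂ ++ l₁) := by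
    rw [en_append] at hc
    simp only [en] at hc
    rw [wt_append, wt_append, hc]
    simp only [wt, if_true]
    ring
  have hen : en j (l₂ ++ l₁) = en i l₁ := by
    rw [en_append] at hc
    simp only [en] at hc
    rw [en_append, hc]
  obtain ⟨p, L, k, e1, e2, e3⟩ := wt_word hA hB (l₂ ++ l₁) j
  rw [hen] at e3
  have hW : wt (fun b => if b then B else A) i (l₁ ++ (true, j) :: l₂)
      ≤ ttr (wordProd A B (p :: L)) := by
    rw [hrot]
    calc _ ≤ B (en i l₁) j * (tpow A p j k * wordProd A B L k (en i l₁)) :=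
            mul_le_mul_of_nonneg_left e3 (hB _ _)
        _ = (B (en i l₁) j * tpow A p j k) * wordProd A B L k (en i l₁) := by ring
        _ ≤ tmul B (tpow A p) (en i l₁) k * wordProd A B L k (en i l₁) :=
            mul_le_mul_of_nonneg_right (tmul_ge _ _ _ _ _) (wordProd_nonneg hA hB _ _ _)
        _ ≤ wordProd A B (p :: L) (en i l₁) (en i l₁) := tmul_ge _ _ _ _ _
        _ ≤ _ := le_sup (fun i => wordProd A B (p :: L) i i) _
  have f1 : (p :: L).sum = nc false (l₁ ++ (true, j) :: l₂) := by
    rw [nc_append] at e1 ⊢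
    simp [nc] at *; omega
  have f2 : (p :: L).length = nc true (l₁ ++ (true, j) :: l₂) := by
    rw [nc_append] at e2 ⊢
    simp [nc] at *; omega
  refine hW.trans ?_
  have := h3 (p :: L).length (p :: L).sum (p :: L).get (by simp) (by omega) (by omega) (by omega)
    (by rw [← List.sum_ofFn, List.ofFn_get])
  rwa [List.ofFn_get, f1, f2] at this

lemma wt_scale {n : ℕ} {A B : Matrix (Fin n) (Fin n) ℝ} {a b : ℝ} (ha : 0 < a) (hb : 0 < b)
    (l : List (Bool × Fin n)) (i : Fin n) :
    wt (fun c => if c then b⁻¹ • B else a⁻¹ • A) i l * (a ^ nc false l * b ^ nc true l)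
      = wt (fun b => if b then B else A) i l := by
  induction l generalizing i with
  | nil => simp [wt, nc]
  | cons q l ih =>
    obtain ⟨c, j⟩ := q
    have := ih j
    simp only [wt]
    rw [← this]
    cases c <;> simp [nc, pow_succ] <;> field_simp

def pp {n : ℕ} (M : Bool → Matrix (Fin n) (Fin n) ℝ) : ℕ → Fin n → ℝ
  | 0, _ => 1
  | k + 1, i => ⨆ q : Bool × Fin n, M q.1 i q.2 * pp M k q.2

lemma pp_wt {n : ℕ} (M : Bool → Matrix (Fin n) (Fin n) ℝ) (k : ℕ) (i : Fin n) :
    ∃ l : List (Bool × Fin n), l.length = k ∧ pp M k i = wt M i l := by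
  induction k generalizing i with
  | zero => exact ⟨[], rfl, rfl⟩
  | succ k ih =>
    have : Nonempty (Bool × Fin n) := ⟨(true, i)⟩
    obtain ⟨q, hq⟩ := exists_eq_ciSup_of_finite (f := fun q : Bool × Fin n => M q.1 i q.2 * pp M k q.2)
    obtain ⟨l, hl, e⟩ := ih q.2
    refine ⟨q :: l, by simp [hl], ?_⟩
    simp only [pp, wt, ← hq, e]

lemma wt_pp {n : ℕ} {M : Bool → Matrix (Fin n) (Fin n) ℝ} (hM : ∀ b i j, 0 ≤ M b i j)
    (r : ℕ) (l : List (Bool × Fin n)) (i : Fin n) :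
    wt M i l * pp M r (en i l) ≤ pp M (r + l.length) i := by
  induction l generalizing i with
  | nil => simp [wt, en]
  | cons q l ih =>
    simp only [wt, en, List.length_cons, ← add_assoc, pp]
    rw [mul_assoc]
    exact (mul_le_mul_of_nonneg_left (ih q.2) (hM _ _ _)).trans
      (le_sup (fun q : Bool × Fin n => M q.1 i q.2 * pp M (r + l.length) q.2) q)

lemma pot {n : ℕ} {M : Bool → Matrix (Fin n) (Fin n) ℝ} (hM : ∀ b i j, 0 ≤ M b i j)
    (hcl : ∀ (l : List (Bool × Fin n)) (i : Fin n), 1 ≤ l.length → l.length ≤ n →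
      en i l = i → wt M i l ≤ 1) :
    ∃ x : Fin n → ℝ, (∀ i, 0 < x i) ∧ ∀ c, Bd x (M c) 1 := by
  have hle : ∀ k : ℕ, k < n → ∀ i, pp M k i ≤ ⨆ k : Fin n, pp M k.1 i := fun k hk i =>
    le_sup (fun k : Fin n => pp M k.1 i) ⟨k, hk⟩
  refine ⟨fun i => ⨆ k : Fin n, pp M k.1 i, fun i => ?_, fun c i j => ?_⟩
  · exact lt_of_lt_of_le one_pos (hle 0 (by have := i.2; omega) i)
  have : Nonempty (Fin n) := ⟨i⟩
  rw [one_mul]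
  obtain ⟨k, hk⟩ := exists_eq_ciSup_of_finite (f := fun k : Fin n => pp M k.1 j)
  simp only at hk ⊢
  rw [← hk]
  have h1 : M c i j * pp M k.1 j ≤ pp M (k.1 + 1) i :=
    le_sup (fun q : Bool × Fin n => M q.1 i q.2 * pp M k.1 q.2) (c, j)
  refine h1.trans ?_
  by_cases hkn : k.1 + 1 < n
  · exact hle _ hkn i
  have hkn : k.1 + 1 = n := by omega
  rw [hkn]
  obtain ⟨l, hl, e⟩ := pp_wt M n i
  obtain ⟨s, t, hst, heq⟩ : ∃ s t : Fin (n + 1), s < t ∧ en i (l.take s) = en i (l.take t) := by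
    obtain ⟨s, t, hne, h⟩ := Fintype.exists_ne_map_eq_of_card_lt
      (fun s : Fin (n + 1) => en i (l.take s)) (by simp)
    rcases lt_or_gt_of_ne hne with h' | h'
    · exact ⟨s, t, h', h⟩
    · exact ⟨t, s, h', h.symm⟩
  have hst' : s.1 < t.1 := hst
  have ht : t.1 ≤ n := by omega
  have d1 : l = l.take t ++ l.drop t := (List.take_append_drop _ _).symm
  have d2 : l.take t = l.take s ++ (l.take t).drop s := by
    conv_lhs => rw [← List.take_append_drop s.1 (l.take t)]
    rw [List.take_take, min_eq_left hst'.le]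
  have hmid : en (en i (l.take s)) ((l.take t).drop s) = en i (l.take s) := by
    rw [← en_append, ← d2, heq]
  have hw := hcl ((l.take t).drop s) (en i (l.take s)) (by simp; omega) (by simp; omega) hmid
  have htail : wt M (en i (l.take s)) (l.drop t) ≤ pp M (n - t.1) (en i (l.take s)) := by
    have := wt_pp hM 0 (l.drop t) (en i (l.take s))
    simpa [pp, hl] using this
  have hfin : wt M i (l.take s) * pp M (n - t.1) (en i (l.take s)) ≤ pp M (n - t.1 + s.1) i := by
    have := wt_pp hM (n - t.1) (l.take s) i
    rwa [List.length_take, hl, min_eq_left (by omega)] at this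
  refine le_trans ?_ (hle (n - t.1 + s.1) (by omega) i)
  refine le_trans ?_ hfin
  rw [e]
  conv_lhs => rw [d1]
  rw [wt_append, ← heq, d2, wt_append]
  have w0 := wt_nonneg hM (l.take s) i
  have w1 := wt_nonneg hM (l.drop t) (en i (l.take s))
  calc _ ≤ wt M i (l.take s) * 1 * wt M (en i (l.take s)) (l.drop t) := by gcongr
    _ = wt M i (l.take s) * wt M (en i (l.take s)) (l.drop t) := by ring
    _ ≤ _ := by gcongr

/-- Sufficiency. -/
lemma suff {n : ℕ} {A B : Matrix (Fin n) (Fin n) ℝ}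
    (hA : ∀ i j, 0 ≤ A i j) (hB : ∀ i j, 0 ≤ B i j) {a b : ℝ} (ha : 0 < a) (hb : 0 < b)
    (h1 : specRad A ≤ a) (h2 : specRad B ≤ b) (h3 : PP A B a b) :
    ∃ x : Fin n → ℝ, (∀ i, 0 < x i) ∧ obj A x ≤ a ∧ obj B x ≤ b := by
  obtain ⟨x, hx, h⟩ := pot (M := fun c => if c then b⁻¹ • B else a⁻¹ • A)
    (by
      intro c i j
      cases c
      · simpa using mul_nonneg (inv_nonneg.2 ha.le) (hA i j)
      · simpa using mul_nonneg (inv_nonneg.2 hb.le) (hB i j))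
    (by
      intro l i hl0 hl hc
      have := closed_le hA hB ha hb h1 h2 h3 l i hl0 hl hc
      rw [← wt_scale ha hb] at this
      have hp : 0 < a ^ nc false l * b ^ nc true l := by positivity
      exact le_of_mul_le_mul_right (by linarith) hp)
  refine ⟨x, hx, obj_le hx ha.le ?_, obj_le hx hb.le ?_⟩
  · intro i j
    have := h false i j
    simp only [Bool.false_eq_true, if_false, Matrix.smul_apply, smul_eq_mul, one_mul] at this
    rwa [mul_assoc, inv_mul_le_iff₀ ha] at this
  · intro i j
    have := h true i j
    simp only [if_true, Matrix.smul_apply, smul_eq_mul, one_mul] at this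
    rwa [mul_assoc, inv_mul_le_iff₀ hb] at this

/-- if `μ < G(ν)`, the Pareto frontier is `{(α, H(α)) : μ ≤ α ≤ G(ν)}`. -/
theorem stmt3 {n : ℕ} (A B : Matrix (Fin n) (Fin n) ℝ)
    (hA : ∀ i j, 0 ≤ A i j) (hB : ∀ i j, 0 ≤ B i j)
    (hμ : 0 < specRad A) (hν : 0 < specRad B)
    (h : specRad A < Gfun A B (specRad B)) :
    ParetoFrontier A B =
      { p : ℝ × ℝ | ∃ α : ℝ, specRad A ≤ α ∧ α ≤ Gfun A B (specRad B) ∧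
        p = (α, Hfun A B α) } := by
  have hn : n ≠ 0 := by
    rintro rfl
    simp [specRad] at hμ
  have hHν : ∀ α, specRad A ≤ α → α ≤ Gfun A B (specRad B) → specRad B ≤ Hfun A B α := by
    intro α h1 h2
    by_contra! hlt
    have ha : 0 < α := hμ.trans_le h1
    have hb : 0 < max (Hfun A B α) (specRad B / 2) := lt_max_of_lt_right (by linarith)
    have hP := (H_le_iff hA hB ha hb).1 (le_max_left _ _)
    obtain ⟨a', a0, a1, hP'⟩ := strict2 hn ha (max_lt hlt (by linarith : specRad B / 2 < specRad B)) hb hP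
    have := (G_le_iff hA hB a0 hν).2 hP'
    linarith
  ext p
  constructor
  · rintro ⟨x, ⟨hx, hopt⟩, rfl⟩
    obtain ⟨n1, n2, n3⟩ := nec hA hB hx
    have ha := hμ.trans_le n1
    have hb := hν.trans_le n2
    have hG : obj A x ≤ Gfun A B (specRad B) := by
      by_contra! hlt
      have g0 := hμ.trans h
      obtain ⟨y, hy, y1, y2⟩ := suff hA hB g0 hν h.le le_rfl ((G_le_iff hA hB g0 hν).1 le_rfl)
      refine hopt ⟨y, hy, by linarith, by linarith, fun e => ?_⟩
      have := (Prod.ext_iff.1 e).1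
      simp only at this
      linarith
    refine ⟨_, n1, hG, ?_⟩
    have hle := (H_le_iff hA hB ha hb).2 n3
    have hge := hHν _ n1 hG
    have h0 := hν.trans_le hge
    congr 1
    by_contra hne
    have hlt := lt_of_le_of_ne hle (Ne.symm hne)
    obtain ⟨y, hy, y1, y2⟩ := suff hA hB ha h0 n1 hge ((H_le_iff hA hB ha h0).1 le_rfl)
    refine hopt ⟨y, hy, by linarith, by linarith, fun e => ?_⟩
    have := (Prod.ext_iff.1 e).2
    simp only at this
    linarith
  · rintro ⟨α, h1, h2, rfl⟩
    have ha := hμ.trans_le h1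
    have hge := hHν _ h1 h2
    have hb := hν.trans_le hge
    have huniq : ∀ y : Fin n → ℝ, (∀ i, 0 < y i) → obj A y ≤ α → obj B y ≤ Hfun A B α →
        obj A y = α ∧ obj B y = Hfun A B α := by
      intro y hy y1 y2
      obtain ⟨n1, n2, n3⟩ := nec hA hB hy
      have ha' := hμ.trans_le n1
      have hb' := hν.trans_le n2
      have hfa : obj A y = α := by
        by_contra hne
        have hlt := lt_of_le_of_ne y1 hne
        obtain ⟨b', b0, b1, hP⟩ := strict1 hn ha' hlt hb' n3
        have := (H_le_iff hA hB ha b0).2 hP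
        linarith
      refine ⟨hfa, le_antisymm y2 ?_⟩
      rw [hfa] at n3
      exact (H_le_iff hA hB ha hb').2 n3
    obtain ⟨y, hy, y1, y2⟩ := suff hA hB ha hb h1 hge ((H_le_iff hA hB ha hb).1 le_rfl)
    obtain ⟨e1, e2⟩ := huniq y hy y1 y2
    refine ⟨y, ⟨hy, ?_⟩, by rw [e1, e2]⟩
    rintro ⟨z, hz, z1, z2, hne⟩
    obtain ⟨f1, f2⟩ := huniq z hz (by linarith) (by linarith)
    exact hne (by rw [e1, e2, f1, f2])
end
end

section
/- For any n×n matrices A and B with nonnegative real entries: Tr(A ⊕ B) = max( max_{1≤k≤n} tr(A^k), max over k = 1,…,n, m = 0,…,n−k, and all k-tuples (i₁,…,i_k) of nonnegative integers with i₁+⋯+i_k = m, of tr(B ⊗ A^{i₁} ⊗ B ⊗ A^{i₂} ⊗ ⋯ ⊗ B ⊗ A^{i_k}) ). -/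
open scoped BigOperators

noncomputable section

section helpers

variable {n : ℕ}

lemma h7_bdd {ι : Type*} [Finite ι] (f : ι → ℝ) : BddAbove (Set.range f) :=
  (Set.finite_range f).bddAbove

lemma h7_le_tmul (X Y : Matrix (Fin n) (Fin n) ℝ) (i k j : Fin n) :
    X i k * Y k j ≤ tmul X Y i j :=
  le_ciSup (f := fun k => X i k * Y k j) (h7_bdd _) k

lemma h7_tmul_le (X Y : Matrix (Fin n) (Fin n) ℝ) (i j : Fin n) (c : ℝ)
    (h : ∀ k, X i k * Y k j ≤ c) : tmul X Y i j ≤ c := by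
  haveI : Nonempty (Fin n) := ⟨i⟩
  exact ciSup_le h

lemma h7_tmul_nn (X Y : Matrix (Fin n) (Fin n) ℝ) (hX : ∀ i j, 0 ≤ X i j)
    (hY : ∀ i j, 0 ≤ Y i j) (i j : Fin n) : 0 ≤ tmul X Y i j :=
  Real.iSup_nonneg fun k => mul_nonneg (hX i k) (hY k j)

lemma h7_tmul_mono {X Y X' Y' : Matrix (Fin n) (Fin n) ℝ}
    (hX' : ∀ i j, 0 ≤ X' i j) (hY : ∀ i j, 0 ≤ Y i j)
    (h1 : ∀ i j, X i j ≤ X' i j) (h2 : ∀ i j, Y i j ≤ Y' i j) (i j : Fin n) :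
    tmul X Y i j ≤ tmul X' Y' i j :=
  h7_tmul_le _ _ _ _ _ fun k =>
    (mul_le_mul (h1 i k) (h2 k j) (hY k j) (hX' i k)).trans (h7_le_tmul X' Y' i k j)

lemma h7_att (X Y : Matrix (Fin n) (Fin n) ℝ) (i j : Fin n) :
    ∃ k, tmul X Y i j = X i k * Y k j := by
  haveI : Nonempty (Fin n) := ⟨i⟩
  obtain ⟨k, hk⟩ := exists_eq_ciSup_of_finite (f := fun k => X i k * Y k j)
  exact ⟨k, hk.symm⟩

lemma h7_assoc (X Y Z : Matrix (Fin n) (Fin n) ℝ) (hX : ∀ i j, 0 ≤ X i j)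
    (hZ : ∀ i j, 0 ≤ Z i j) :
    tmul (tmul X Y) Z = tmul X (tmul Y Z) := by
  ext i j
  apply le_antisymm
  · apply h7_tmul_le
    intro k
    obtain ⟨l, hl⟩ := h7_att X Y i k
    rw [hl, mul_assoc]
    exact (mul_le_mul_of_nonneg_left (h7_le_tmul Y Z l k j) (hX i l)).trans
      (h7_le_tmul _ _ i l j)
  · apply h7_tmul_le
    intro k
    obtain ⟨l, hl⟩ := h7_att Y Z k j
    rw [hl, ← mul_assoc]
    exact (mul_le_mul_of_nonneg_right (h7_le_tmul X Y i k l) (hZ l j)).trans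
      (h7_le_tmul _ _ i l j)

lemma h7_one_nn (A : Matrix (Fin n) (Fin n) ℝ) (i j : Fin n) : 0 ≤ tpow A 0 i j := by
  simp only [tpow, Matrix.of_apply]; split_ifs <;> norm_num

lemma h7_one_mul (A X : Matrix (Fin n) (Fin n) ℝ) (hX : ∀ i j, 0 ≤ X i j) :
    tmul (tpow A 0) X = X := by
  ext i j
  apply le_antisymm
  · apply h7_tmul_le
    intro k
    simp only [tpow, Matrix.of_apply]
    split_ifs with h
    · subst h; simp
    · simpa using hX i j
  · have := h7_le_tmul (tpow A 0) X i i j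
    simpa [tpow] using this

lemma h7_mul_one (A X : Matrix (Fin n) (Fin n) ℝ) (hX : ∀ i j, 0 ≤ X i j) :
    tmul X (tpow A 0) = X := by
  ext i j
  apply le_antisymm
  · apply h7_tmul_le
    intro k
    simp only [tpow, Matrix.of_apply]
    split_ifs with h
    · subst h; simp
    · simpa using hX i j
  · have := h7_le_tmul X (tpow A 0) i j j
    simpa [tpow] using this

lemma h7_pow_nn (A : Matrix (Fin n) (Fin n) ℝ) (hA : ∀ i j, 0 ≤ A i j) (p : ℕ) :
    ∀ i j, 0 ≤ tpow A p i j := by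
  induction p with
  | zero => exact h7_one_nn A
  | succ p ih => exact h7_tmul_nn _ _ hA ih

lemma h7_pow_add (A : Matrix (Fin n) (Fin n) ℝ) (hA : ∀ i j, 0 ≤ A i j) (p q : ℕ) :
    tpow A (p + q) = tmul (tpow A p) (tpow A q) := by
  induction p with
  | zero => rw [Nat.zero_add, h7_one_mul A _ (h7_pow_nn A hA q)]
  | succ p ih =>
    rw [show p + 1 + q = (p + q) + 1 by omega]
    change tmul A (tpow A (p + q)) = tmul (tmul A (tpow A p)) (tpow A q)
    rw [ih, h7_assoc _ _ _ hA (h7_pow_nn A hA q)]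

lemma h7_word_nn (A B : Matrix (Fin n) (Fin n) ℝ) (hA : ∀ i j, 0 ≤ A i j)
    (hB : ∀ i j, 0 ≤ B i j) (l : List ℕ) : ∀ i j, 0 ≤ wordProd A B l i j := by
  induction l with
  | nil => exact h7_one_nn A
  | cons a l ih => exact h7_tmul_nn _ _ (h7_tmul_nn _ _ hB (h7_pow_nn A hA a)) ih

lemma h7_pow_mono (A C : Matrix (Fin n) (Fin n) ℝ) (hA : ∀ i j, 0 ≤ A i j)
    (h : ∀ i j, A i j ≤ C i j) (p : ℕ) : ∀ i j, tpow A p i j ≤ tpow C p i j := by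
  induction p with
  | zero => intro i j; exact le_rfl
  | succ p ih =>
    exact h7_tmul_mono (fun i j => (hA i j).trans (h i j)) (h7_pow_nn A hA p) h ih

lemma h7_word_le (A B C : Matrix (Fin n) (Fin n) ℝ) (hA : ∀ i j, 0 ≤ A i j)
    (hB : ∀ i j, 0 ≤ B i j) (hAC : ∀ i j, A i j ≤ C i j) (hBC : ∀ i j, B i j ≤ C i j)
    (l : List ℕ) : ∀ i j, wordProd A B l i j ≤ tpow C (l.length + l.sum) i j := by
  have hC : ∀ i j, 0 ≤ C i j := fun i j => (hA i j).trans (hAC i j)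
  induction l with
  | nil => intro i j; exact le_rfl
  | cons a l ih =>
    have e : (a :: l).length + (a :: l).sum = (a + 1) + (l.length + l.sum) := by
      simp; omega
    rw [e, h7_pow_add C hC]
    exact h7_tmul_mono (h7_pow_nn C hC (a + 1)) (h7_word_nn A B hA hB l)
      (h7_tmul_mono hC (h7_pow_nn A hA a) hBC (h7_pow_mono A C hA hAC a)) ih

lemma h7_expand (A B : Matrix (Fin n) (Fin n) ℝ) (hA : ∀ i j, 0 ≤ A i j)
    (hB : ∀ i j, 0 ≤ B i j) (p : ℕ) : ∀ i j, ∃ (m : ℕ) (l : List ℕ),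
      m + (l.length + l.sum) = p ∧
      tpow (Matrix.of fun i j => max (A i j) (B i j)) p i j ≤
        tmul (tpow A m) (wordProd A B l) i j := by
  induction p with
  | zero =>
    intro i j
    refine ⟨0, [], rfl, ?_⟩
    rw [h7_one_mul A _ (h7_word_nn A B hA hB [])]
    exact le_rfl
  | succ p ih =>
    intro i j
    obtain ⟨k, hk⟩ := h7_att (Matrix.of fun i j => max (A i j) (B i j))
      (tpow (Matrix.of fun i j => max (A i j) (B i j)) p) i j
    obtain ⟨m, l, hp, hle⟩ := ih k j
    have hW := h7_word_nn A B hA hB l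
    have hP := h7_pow_nn A hA m
    change ∃ (m : ℕ) (l : List ℕ), _ ∧ tmul _ _ i j ≤ _
    rw [hk]
    rcases le_total (A i k) (B i k) with h | h
    · refine ⟨0, m :: l, by simp; omega, ?_⟩
      rw [h7_one_mul A _ (h7_word_nn A B hA hB _)]
      change _ ≤ tmul (tmul B (tpow A m)) (wordProd A B l) i j
      rw [h7_assoc _ _ _ hB hW, Matrix.of_apply, max_eq_right h]
      exact (mul_le_mul_of_nonneg_left hle (hB i k)).trans (h7_le_tmul _ _ i k j)
    · refine ⟨m + 1, l, by omega, ?_⟩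
      change _ ≤ tmul (tmul A (tpow A m)) (wordProd A B l) i j
      rw [h7_assoc _ _ _ hA hW, Matrix.of_apply, max_eq_left h]
      exact (mul_le_mul_of_nonneg_left hle (hA i k)).trans (h7_le_tmul _ _ i k j)

lemma h7_le_ttr (X : Matrix (Fin n) (Fin n) ℝ) (i : Fin n) : X i i ≤ ttr X :=
  le_ciSup (f := fun i => X i i) (h7_bdd _) i

lemma h7_word_mul (A B : Matrix (Fin n) (Fin n) ℝ) (hA : ∀ i j, 0 ≤ A i j)
    (hB : ∀ i j, 0 ≤ B i j) (m : ℕ) (l : List ℕ) (hl : l ≠ []) :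
    ∃ l' : List ℕ, l'.length = l.length ∧ l'.sum = l.sum + m ∧
      tmul (wordProd A B l) (tpow A m) = wordProd A B l' := by
  have hP := h7_pow_nn A hA
  induction l with
  | nil => exact absurd rfl hl
  | cons a l ih =>
    by_cases h : l = []
    · subst h
      refine ⟨[a + m], rfl, by simp, ?_⟩
      simp only [wordProd]
      rw [h7_mul_one A _ (h7_tmul_nn _ _ hB (hP a)),
        h7_mul_one A _ (h7_tmul_nn _ _ hB (hP _)), h7_assoc _ _ _ hB (hP m),
        h7_pow_add A hA]
    · obtain ⟨l', h1, h2, h3⟩ := ih h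
      refine ⟨a :: l', by simp [h1], by simp [h2]; omega, ?_⟩
      simp only [wordProd]
      rw [h7_assoc _ _ _ (h7_tmul_nn _ _ hB (hP a)) (hP m), h3]

lemma h7_cyc (X Y : Matrix (Fin n) (Fin n) ℝ) (i : Fin n) :
    tmul X Y i i ≤ ttr (tmul Y X) := by
  apply h7_tmul_le
  intro k
  rw [mul_comm]
  exact (h7_le_tmul Y X k i k).trans (h7_le_ttr _ k)

lemma h7_le_tTr (X : Matrix (Fin n) (Fin n) ℝ) (p : ℕ) (h1 : 1 ≤ p) (h2 : p ≤ n)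
    (i : Fin n) : tpow X p i i ≤ tTr X := by
  have := le_ciSup (f := fun k : Fin n => ttr (tpow X (k.1 + 1))) (h7_bdd _)
    ⟨p - 1, by omega⟩
  simp only [Nat.sub_add_cancel h1] at this
  exact (h7_le_ttr _ i).trans this

end helpers

/-- the trace identity for `Tr(A ⊕ B)`. -/
theorem stmt7 {n : ℕ} (A B : Matrix (Fin n) (Fin n) ℝ)
    (hA : ∀ i j, 0 ≤ A i j) (hB : ∀ i j, 0 ≤ B i j) :
    tTr (Matrix.of fun i j => max (A i j) (B i j)) =
      max (tTr A)
        (sSup { v : ℝ | ∃ (k m : ℕ) (t : Fin k → ℕ),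
          1 ≤ k ∧ k ≤ n ∧ m ≤ n - k ∧ (∑ j, t j) = m ∧
          v = ttr (wordProd A B (List.ofFn t)) }) := by
  set C : Matrix (Fin n) (Fin n) ℝ := Matrix.of fun i j => max (A i j) (B i j) with hCdef
  have hAC : ∀ i j, A i j ≤ C i j := fun i j => le_max_left _ _
  have hBC : ∀ i j, B i j ≤ C i j := fun i j => le_max_right _ _
  have hC : ∀ i j, 0 ≤ C i j := fun i j => (hA i j).trans (hAC i j)
  rcases Nat.eq_zero_or_pos n with hn | hn
  · subst hn
    have h0 : ∀ X : Matrix (Fin 0) (Fin 0) ℝ, tTr X = 0 := fun X => by simp [tTr]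
    rw [h0, h0]
    have : { v : ℝ | ∃ (k m : ℕ) (t : Fin k → ℕ),
          1 ≤ k ∧ k ≤ 0 ∧ m ≤ 0 - k ∧ (∑ j, t j) = m ∧
          v = ttr (wordProd A B (List.ofFn t)) } = ∅ := by
      ext v
      simp only [Set.mem_setOf_eq, Set.mem_empty_iff_false, iff_false]
      rintro ⟨k, m, t, h1, h2, -⟩
      omega
    rw [this]; simp
  haveI : Nonempty (Fin n) := ⟨⟨0, hn⟩⟩
  have hub : ∀ v ∈ { v : ℝ | ∃ (k m : ℕ) (t : Fin k → ℕ),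
          1 ≤ k ∧ k ≤ n ∧ m ≤ n - k ∧ (∑ j, t j) = m ∧
          v = ttr (wordProd A B (List.ofFn t)) }, v ≤ tTr C := by
    rintro v ⟨k, m, t, h1, h2, h3, h4, rfl⟩
    apply ciSup_le
    intro i
    have hs : (List.ofFn t).sum = m := by rw [List.sum_ofFn, h4]
    refine (h7_word_le A B C hA hB hAC hBC _ i i).trans (h7_le_tTr C _ ?_ ?_ i)
    · rw [List.length_ofFn]; omega
    · rw [List.length_ofFn, hs]; omega
  apply le_antisymm
  · apply ciSup_le
    intro p
    apply ciSup_le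
    intro i
    obtain ⟨m, l, hp, hle⟩ := h7_expand A B hA hB (p.1 + 1) i i
    refine hle.trans ?_
    by_cases hl : l = []
    · subst hl
      apply le_max_of_le_left
      simp only [wordProd]
      rw [h7_mul_one A _ (h7_pow_nn A hA m)]
      simp at hp
      exact h7_le_tTr A m (by omega) (by omega) i
    · apply le_max_of_le_right
      obtain ⟨l', h1, h2, h3⟩ := h7_word_mul A B hA hB m l hl
      refine (h7_cyc _ _ i).trans ?_
      rw [h3]
      have hlen := List.length_pos_of_ne_nil hl
      have hp2 := p.2
      refine le_csSup ⟨tTr C, hub⟩ ⟨l'.length, l'.sum, l'.get, by omega, by omega, by omega, ?_, ?_⟩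
      · rw [← List.sum_ofFn, List.ofFn_get]
      · rw [List.ofFn_get]
  · apply max_le
    · apply ciSup_le
      intro p
      apply ciSup_le
      intro i
      exact (h7_pow_mono A C hA hAC _ i i).trans (h7_le_tTr C _ (by omega) (by omega) i)
    · refine csSup_le ⟨_, 1, 0, fun _ => 0, le_rfl, hn, by omega, by simp, rfl⟩ hub
end
end

section
/- Let a and b be positive real numbers with a ≠ b, let A = [[1, a], [1/a, 1]] and B = [[1, b], [1/b, 1]], and set c = max(a/b, b/a). Then: (i) the tropical spectral radii of A and B both equal 1 and tr(B⊗A) = c > 1; (ii) the Pareto frontier of the problem of minimizing (f(x), g(x)) over positive vectors x ∈ ℝ² equals {(α, c/α) : 1 ≤ α ≤ c}; and (iii) a positive vector x ∈ ℝ² is Pareto-optimal if and only if min(a, b) ≤ x₁/x₂ ≤ max(a, b). -/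
open scoped BigOperators

noncomputable section

theorem aux_sup2 (f : Fin 2 → ℝ) : (⨆ i, f i) = max (f 0) (f 1) := by
  apply le_antisymm
  · apply ciSup_le
    intro i
    fin_cases i
    · exact le_max_left _ _
    · exact le_max_right _ _
  · exact max_le (le_ciSup (Set.finite_range f).bddAbove 0)
      (le_ciSup (Set.finite_range f).bddAbove 1)

theorem aux_M_one (a r : ℝ) (ha : 0 < a) (hr : 0 < r) : 1 ≤ max (a / r) (r / a) := by
  rcases le_total a r with h | h
  · exact le_max_of_le_right ((one_le_div ha).2 h)
  · exact le_max_of_le_left ((one_le_div hr).2 h)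

theorem aux_M_left (a r : ℝ) (hr : 0 < r) (h : r ≤ a) :
    max (a / r) (r / a) = a / r := by
  have ha : 0 < a := hr.trans_le h
  exact max_eq_left (((div_le_one ha).2 h).trans ((one_le_div hr).2 h))

theorem aux_M_right (a r : ℝ) (ha : 0 < a) (h : a ≤ r) :
    max (a / r) (r / a) = r / a := by
  rw [max_comm]; exact aux_M_left r a ha h

theorem aux_obj (a : ℝ) (ha : 0 < a) (x : Fin 2 → ℝ) (hx : ∀ i, 0 < x i) :
    obj (Matrix.of ![![1, a], ![a⁻¹, 1]]) x = max (a / (x 0 / x 1)) (x 0 / x 1 / a) := by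
  have h0 := hx 0
  have h1 := hx 1
  have h := aux_M_one a (x 0 / x 1) ha (div_pos h0 h1)
  have e1 : a * x 1 / x 0 = a / (x 0 / x 1) := by field_simp
  have e2 : a⁻¹ * x 0 / x 1 = x 0 / x 1 / a := by field_simp
  simp only [obj, aux_sup2]
  simp only [Matrix.of_apply, Matrix.cons_val_zero, Matrix.cons_val_one, one_mul,
    div_self h0.ne', div_self h1.ne', e1, e2]
  generalize a / (x 0 / x 1) = p at *
  generalize x 0 / x 1 / a = q at *
  grind

theorem aux_spec (a : ℝ) (ha : 0 < a) :
    specRad (Matrix.of ![![1, a], ![a⁻¹, 1]]) = 1 := by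
  simp [specRad, aux_sup2, ttr, tpow, tmul, ha.ne', ha.le]

theorem aux_prod (a b r : ℝ) (ha : 0 < a) (hb : 0 < b) (hr : 0 < r) :
    max (a / b) (b / a) ≤ max (a / r) (r / a) * max (b / r) (r / b) := by
  apply max_le
  · calc a / b = (a / r) * (r / b) := by field_simp
      _ ≤ _ := mul_le_mul (le_max_left _ _) (le_max_right _ _) (by positivity) (by positivity)
  · calc b / a = (r / a) * (b / r) := by field_simp
      _ ≤ _ := mul_le_mul (le_max_right _ _) (le_max_left _ _) (by positivity) (by positivity)

theorem aux_prod_eq (a b r : ℝ) (ha : 0 < a) (hb : 0 < b) (hr : 0 < r)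
    (h1 : min a b ≤ r) (h2 : r ≤ max a b) :
    max (a / r) (r / a) * max (b / r) (r / b) = max (a / b) (b / a) := by
  rcases le_total a b with h | h
  · rw [min_eq_left h] at h1
    rw [max_eq_right h] at h2
    rw [aux_M_right a r ha h1, aux_M_left b r hr h2, aux_M_right a b ha h]
    field_simp
  · rw [min_eq_right h] at h1
    rw [max_eq_left h] at h2
    rw [aux_M_left a r hr h2, aux_M_right b r hb h1, aux_M_left a b hb h]
    field_simp

theorem aux_lt1 (a r s : ℝ) (hr : 0 < r) (h1 : r < s) (h2 : s ≤ a) :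
    max (a / s) (s / a) < max (a / r) (r / a) := by
  rw [aux_M_left a s (hr.trans h1) h2, aux_M_left a r hr (h1.le.trans h2)]
  exact div_lt_div_of_pos_left (by linarith) hr h1

theorem aux_lt2 (a r s : ℝ) (ha : 0 < a) (h1 : s < r) (h2 : a ≤ s) :
    max (a / s) (s / a) < max (a / r) (r / a) := by
  rw [aux_M_right a s ha h2, aux_M_right a r ha (h2.trans h1.le)]
  exact div_lt_div_of_pos_right h1 ha

theorem aux_pareto (a b : ℝ) (ha : 0 < a) (hb : 0 < b) (x : Fin 2 → ℝ) (hx : ∀ i, 0 < x i) :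
    ParetoOptimal (Matrix.of ![![1, a], ![a⁻¹, 1]]) (Matrix.of ![![1, b], ![b⁻¹, 1]]) x ↔
      min a b ≤ x 0 / x 1 ∧ x 0 / x 1 ≤ max a b := by
  have hr : 0 < x 0 / x 1 := div_pos (hx 0) (hx 1)
  constructor
  · rintro ⟨-, h⟩
    have key : ∀ s : ℝ, 0 < s →
        max (a / s) (s / a) < max (a / (x 0 / x 1)) (x 0 / x 1 / a) →
        max (b / s) (s / b) < max (b / (x 0 / x 1)) (x 0 / x 1 / b) → False := by
      intro s hs h1 h2
      have hy : ∀ i, 0 < (![s, 1] : Fin 2 → ℝ) i := by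
        intro i; fin_cases i <;> simp [hs]
      refine h ⟨![s, 1], hy, ?_⟩
      rw [aux_obj a ha _ hy, aux_obj b hb _ hy, aux_obj a ha x hx, aux_obj b hb x hx]
      have e : (![s, 1] : Fin 2 → ℝ) 0 / (![s, 1] : Fin 2 → ℝ) 1 = s := by simp
      rw [e]
      exact ⟨h1.le, h2.le, fun h => h1.ne (Prod.ext_iff.1 h).1⟩
    constructor
    · by_contra! hlt
      exact key (min a b) (lt_min ha hb) (aux_lt1 a _ _ hr hlt (min_le_left _ _))
        (aux_lt1 b _ _ hr hlt (min_le_right _ _))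
    · by_contra! hlt
      exact key (max a b) (lt_max_of_lt_left ha) (aux_lt2 a _ _ ha hlt (le_max_left _ _))
        (aux_lt2 b _ _ hb hlt (le_max_right _ _))
  · rintro ⟨h1, h2⟩
    refine ⟨hx, ?_⟩
    rintro ⟨y, hy, hf, hg, hne⟩
    have hs : 0 < y 0 / y 1 := div_pos (hy 0) (hy 1)
    rw [aux_obj a ha y hy, aux_obj b hb y hy, aux_obj a ha x hx, aux_obj b hb x hx] at hne
    rw [aux_obj a ha y hy, aux_obj a ha x hx] at hf
    rw [aux_obj b hb y hy, aux_obj b hb x hx] at hg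
    have p1 := aux_prod a b _ ha hb hs
    rw [← aux_prod_eq a b _ ha hb hr h1 h2] at p1
    have q1 := aux_M_one a _ ha hs
    have q2 := aux_M_one b _ hb hs
    have q3 := aux_M_one a _ ha hr
    have q4 := aux_M_one b _ hb hr
    apply hne
    generalize max (a / (y 0 / y 1)) (y 0 / y 1 / a) = p at *
    generalize max (b / (y 0 / y 1)) (y 0 / y 1 / b) = q at *
    generalize max (a / (x 0 / x 1)) (x 0 / x 1 / a) = p' at *
    generalize max (b / (x 0 / x 1)) (x 0 / x 1 / b) = q' at *
    have e1 : p = p' := by nlinarith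
    have e2 : q = q' := by nlinarith
    rw [e1, e2]

/-- the symmetrically reciprocal 2×2 example. -/
theorem stmt19 (a b : ℝ) (ha : 0 < a) (hb : 0 < b) (hab : a ≠ b)
    (A B : Matrix (Fin 2) (Fin 2) ℝ)
    (hA : A = Matrix.of ![![1, a], ![a⁻¹, 1]])
    (hB : B = Matrix.of ![![1, b], ![b⁻¹, 1]])
    (c : ℝ) (hc : c = max (a / b) (b / a)) :
    (specRad A = 1 ∧ specRad B = 1 ∧ ttr (tmul B A) = c ∧ 1 < c) ∧
    ParetoFrontier A B =
      { p : ℝ × ℝ | ∃ α : ℝ, 1 ≤ α ∧ α ≤ c ∧ p = (α, c / α) } ∧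
    (∀ x : Fin 2 → ℝ, (∀ i, 0 < x i) →
      (ParetoOptimal A B x ↔ min a b ≤ x 0 / x 1 ∧ x 0 / x 1 ≤ max a b)) := by
  subst hA hB
  have hc1 : 1 < c := by
    rw [hc]
    rcases lt_or_gt_of_ne hab with h | h
    · exact lt_max_of_lt_right ((one_lt_div ha).2 h)
    · exact lt_max_of_lt_left ((one_lt_div hb).2 h)
  refine ⟨⟨aux_spec a ha, aux_spec b hb, ?_, hc1⟩, ?_, fun x hx => aux_pareto a b ha hb x hx⟩
  · have e1 : b * a⁻¹ = b / a := by field_simp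
    have e2 : b⁻¹ * a = a / b := by field_simp
    simp only [ttr, tmul, aux_sup2, Matrix.of_apply, Matrix.cons_val_zero, Matrix.cons_val_one,
      one_mul, mul_one, e1, e2]
    rw [hc] at hc1 ⊢
    generalize a / b = p at *
    generalize b / a = q at *
    grind
  · ext p
    constructor
    · rintro ⟨x, hp, rfl⟩
      have hx := hp.1
      have hr : 0 < x 0 / x 1 := div_pos (hx 0) (hx 1)
      obtain ⟨h1, h2⟩ := (aux_pareto a b ha hb x hx).1 hp
      have e := aux_prod_eq a b _ ha hb hr h1 h2
      have q3 := aux_M_one a _ ha hr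
      have q4 := aux_M_one b _ hb hr
      rw [← hc] at e
      rw [aux_obj a ha x hx, aux_obj b hb x hx]
      refine ⟨_, q3, ?_, ?_⟩
      · rw [← e]; exact le_mul_of_one_le_right (by linarith) q4
      · rw [← e, mul_div_cancel_left₀ _ (by linarith)]
    · rintro ⟨α, h1, h2, rfl⟩
      have hα : 0 < α := by linarith
      obtain ⟨r, hr, hl, hu, he⟩ : ∃ r : ℝ, 0 < r ∧ min a b ≤ r ∧ r ≤ max a b ∧
          max (a / r) (r / a) = α := by
        rcases le_total a b with h | h
        · rw [aux_M_right a b ha h] at hc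
          rw [hc, le_div_iff₀ ha] at h2
          have h3 : a ≤ α * a := by nlinarith
          refine ⟨α * a, by positivity, min_le_of_left_le h3, le_max_of_le_right h2, ?_⟩
          rw [aux_M_right a _ ha h3]
          field_simp
        · rw [aux_M_left a b hb h] at hc
          rw [hc, le_div_iff₀ hb] at h2
          have h3 : a / α ≤ a := div_le_self ha.le h1
          refine ⟨a / α, by positivity, min_le_of_right_le ?_, le_max_of_le_left h3, ?_⟩
          · rw [le_div_iff₀ hα]; linarith
          · rw [aux_M_left a _ (by positivity) h3]
            field_simp
      have hy : ∀ i, 0 < (![r, 1] : Fin 2 → ℝ) i := by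
        intro i; fin_cases i <;> simp [hr]
      have e : (![r, 1] : Fin 2 → ℝ) 0 / (![r, 1] : Fin 2 → ℝ) 1 = r := by simp
      refine ⟨![r, 1], (aux_pareto a b ha hb _ hy).2 (by rw [e]; exact ⟨hl, hu⟩), ?_⟩
      have e2 := aux_prod_eq a b _ ha hb hr hl hu
      rw [aux_obj a ha _ hy, aux_obj b hb _ hy, e, hc, ← e2, he, mul_div_cancel_left₀ _ hα.ne']
end
end
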